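/- arXiv:math/9911161 — 2 statements merged into one kernel-verified Lean document; each statement's English description precedes it below -/
import Mathlib

section
/- Let Y ⊆ ℙ^M_ℂ be an irreducible Zariski-closed subset whose linear span is a linear subspace of projective dimension p + 1. Fix integers d ≥ 1 and 0 ≤ r − 1 ≤ k ≤ d, and a ℂ-linear map Ψ : 𝓛_d → ℂ^{k+1}. Suppose that for a general choice of points y₁,…,y_{r−1} ∈ Y (i.e. for all (r−1)-tuples in some nonempty Zariski-open dense subset of Y^{r−1}), the restriction of Ψ to 𝓛_d(−y₁−⋯−y_{r−1}) is surjective onto ℂ^{k+1}. Then for a general choice of y₁,…,y_{r−1} ∈ Y, of elements h_{k+1},…,h_d ∈ 𝓛, and of subsets Y₁,…,Y_k ⊂ Y each of cardinality p with y_i ∈ Y_i for i = 1,…,r−1, the restriction of Ψ to the subspace 𝓛(−Y₁)⋯𝓛(−Y_k)·h_{k+1}⋯h_d of 𝓛_d is surjective onto ℂ^{k+1}. Here again 'general' means that the set of admissible choices contains a nonempty Zariski-open dense subset of the corresponding parameter variety. -/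
open MvPolynomial

/-- The linear form on `ℙ^M` with coefficient vector `v`. -/
noncomputable def linFormOf (M : ℕ) (v : Fin (M + 1) → ℂ) :
    MvPolynomial (Fin (M + 1)) ℂ :=
  ∑ t, C (v t) * X t

open Submodule
open Function (update update_of_ne forall_update_iff)

section Regular

variable {ι : Type*} {m : ℕ} {R : Type*} [CommRing R] [Algebra ℂ R]

/-- The `R`-valued polynomial functions of a family of vectors of `ℂ^m` indexed by `ι`. -/
def regularFun (ι : Type*) (m : ℕ) (R : Type*) [CommRing R] [Algebra ℂ R] :
    Subalgebra R ((ι → Fin m → ℂ) → R) :=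
  Algebra.adjoin R (Set.range fun (q : ι × Fin m) x => algebraMap ℂ R (x q.1 q.2))

lemma coord_mem_regularFun (i : ι) (t : Fin m) :
    (fun x : ι → Fin m → ℂ => algebraMap ℂ R (x i t)) ∈ regularFun ι m R :=
  Algebra.subset_adjoin ⟨(i, t), rfl⟩

lemma const_mem_regularFun (a : R) :
    (fun _ : ι → Fin m → ℂ => a) ∈ regularFun ι m R :=
  (regularFun ι m R).algebraMap_mem a

lemma algebraMap_mem_regularFun {f : (ι → Fin m → ℂ) → ℂ} (hf : f ∈ regularFun ι m ℂ) :
    (fun x => algebraMap ℂ R (f x)) ∈ regularFun ι m R := by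
  induction hf using Algebra.adjoin_induction with
  | mem f hf =>
    obtain ⟨q, rfl⟩ := hf
    exact coord_mem_regularFun q.1 q.2
  | algebraMap a => exact const_mem_regularFun (algebraMap ℂ R a)
  | add f g _ _ hf hg => simpa only [Pi.add_apply, map_add] using! add_mem hf hg
  | mul f g _ _ hf hg => simpa only [Pi.mul_apply, map_mul] using! mul_mem hf hg

lemma exists_eval_eq_of_mem_regularFun {f : (ι → Fin m → ℂ) → R} (hf : f ∈ regularFun ι m R) :
    ∃ P : MvPolynomial (ι × Fin m) R,
      ∀ x, f x = eval (fun q => algebraMap ℂ R (x q.1 q.2)) P := by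
  induction hf using Algebra.adjoin_induction with
  | mem f hf =>
    obtain ⟨q, rfl⟩ := hf
    exact ⟨X q, fun x => by simp⟩
  | algebraMap a => exact ⟨C a, fun x => by simp⟩
  | add f g _ _ hf hg =>
    obtain ⟨P, hP⟩ := hf
    obtain ⟨Q, hQ⟩ := hg
    exact ⟨P + Q, fun x => by simp [hP, hQ]⟩
  | mul f g _ _ hf hg =>
    obtain ⟨P, hP⟩ := hf
    obtain ⟨Q, hQ⟩ := hg
    exact ⟨P * Q, fun x => by simp [hP, hQ]⟩

lemma exists_eval_update_eq [DecidableEq ι] {f : (ι → Fin m → ℂ) → ℂ}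
    (hf : f ∈ regularFun ι m ℂ) (x : ι → Fin m → ℂ) (i : ι) :
    ∃ P : MvPolynomial (Fin m) ℂ, ∀ v, f (update x i v) = eval v P := by
  induction hf using Algebra.adjoin_induction with
  | mem f hf =>
    obtain ⟨q, rfl⟩ := hf
    by_cases h : q.1 = i
    · exact ⟨X q.2, fun v => by simp [h]⟩
    · exact ⟨C (x q.1 q.2), fun v => by simp [update_of_ne h]⟩
  | algebraMap a => exact ⟨C a, fun x => by simp⟩
  | add f g _ _ hf hg =>
    obtain ⟨P, hP⟩ := hf
    obtain ⟨Q, hQ⟩ := hg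
    exact ⟨P + Q, fun x => by simp [hP, hQ]⟩
  | mul f g _ _ hf hg =>
    obtain ⟨P, hP⟩ := hf
    obtain ⟨Q, hQ⟩ := hg
    exact ⟨P * Q, fun x => by simp [hP, hQ]⟩

lemma linearMap_comp_mem_regularFun (l : R →ₗ[ℂ] ℂ) {f : (ι → Fin m → ℂ) → R}
    (hf : f ∈ regularFun ι m R) : (fun x => l (f x)) ∈ regularFun ι m ℂ := by
  obtain ⟨P, hP⟩ := exists_eval_eq_of_mem_regularFun hf
  simp only [hP]
  clear hP hf f
  induction P using MvPolynomial.induction_on with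
  | C a => simpa using const_mem_regularFun (l a)
  | add P Q hP hQ => simpa only [map_add] using! add_mem hP hQ
  | mul_X P q hP =>
    have h (x : ι → Fin m → ℂ) (a : R) :
        l (a * algebraMap ℂ R (x q.1 q.2)) = l a * x q.1 q.2 := by
      rw [mul_comm, ← Algebra.smul_def, map_smul, smul_eq_mul, mul_comm]
    simpa only [map_mul, eval_X, h] using! mul_mem hP (coord_mem_regularFun (R := ℂ) q.1 q.2)

lemma det_mem_regularFun {n : Type*} [Fintype n] [DecidableEq n]
    {A : (ι → Fin m → ℂ) → Matrix n n R}
    (hA : ∀ i j, (fun x => A x i j) ∈ regularFun ι m R) :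
    (fun x => (A x).det) ∈ regularFun ι m R := by
  have h : (fun x => (A x).det) =
      (Matrix.of fun i j x => A x i j : Matrix n n ((ι → Fin m → ℂ) → R)).det := by
    ext x
    exact ((Pi.evalRingHom (fun _ => R) x).map_det (Matrix.of fun i j x => A x i j)).symm
  rw [h, Matrix.det_apply]
  refine sum_mem fun σ _ => ?_
  rw [Units.smul_def]
  exact zsmul_mem (prod_mem fun i _ => hA _ _) _

/-- A subset of `ℂ^m` whose polynomial functions form a domain. -/
def ZariskiIrreducible (S : Set (Fin m → ℂ)) : Prop :=
  ∀ f g : MvPolynomial (Fin m) ℂ, (∀ x ∈ S, eval x f * eval x g = 0) →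
    (∀ x ∈ S, eval x f = 0) ∨ (∀ x ∈ S, eval x g = 0)

lemma zariskiIrreducible_univ : ZariskiIrreducible (Set.univ : Set (Fin m → ℂ)) := by
  intro f g h
  have : f * g = 0 := MvPolynomial.funext fun x => by simpa using h x trivial
  rcases mul_eq_zero.1 this with rfl | rfl <;> simp

variable {S : ι → Set (Fin m → ℂ)} {f g : (ι → Fin m → ℂ) → ℂ}

lemma ZariskiIrreducible.exists_update_ne_zero [DecidableEq ι] {i : ι}
    (hS : ZariskiIrreducible (S i)) (hf : f ∈ regularFun ι m ℂ) (hg : g ∈ regularFun ι m ℂ)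
    {s t : ι → Fin m → ℂ} (hs : s i ∈ S i) (ht : t i ∈ S i) (hfs : f s ≠ 0) (hgt : g t ≠ 0) :
    ∃ v ∈ S i, f (update s i v) ≠ 0 ∧ g (update t i v) ≠ 0 := by
  obtain ⟨P, hP⟩ := exists_eval_update_eq hf s i
  obtain ⟨Q, hQ⟩ := exists_eval_update_eq hg t i
  by_contra! h
  rcases hS P Q fun v hv => by
      rw [← hP, ← hQ]
      by_cases h0 : f (update s i v) = 0
      · rw [h0, zero_mul]
      · rw [h v hv h0, mul_zero] with h | h
  · exact hfs (by simpa [← hP] using h _ hs)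
  · exact hgt (by simpa [← hQ] using h _ ht)

/-- A product of finitely many irreducible sets is irreducible. -/
lemma exists_forall_mem_and_ne_zero [Fintype ι] (hS : ∀ i, ZariskiIrreducible (S i))
    (hf : f ∈ regularFun ι m ℂ) (hg : g ∈ regularFun ι m ℂ) {s t : ι → Fin m → ℂ}
    (hs : ∀ i, s i ∈ S i) (ht : ∀ i, t i ∈ S i) (hfs : f s ≠ 0) (hgt : g t ≠ 0) :
    ∃ u, (∀ i, u i ∈ S i) ∧ f u ≠ 0 ∧ g u ≠ 0 := by
  classical
  suffices H : ∀ (F : Finset ι) (s t : ι → Fin m → ℂ), (∀ i, s i ∈ S i) → (∀ i, t i ∈ S i) →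
      f s ≠ 0 → g t ≠ 0 → (∀ i ∉ F, s i = t i) → ∃ u, (∀ i, u i ∈ S i) ∧ f u ≠ 0 ∧ g u ≠ 0 from
    H Finset.univ s t hs ht hfs hgt (by simp)
  intro F
  induction F using Finset.induction_on with
  | empty =>
    intro s t hs ht hfs hgt hst
    obtain rfl : s = t := funext fun i => hst i (by simp)
    exact ⟨s, hs, hfs, hgt⟩
  | insert a F _ ih =>
    intro s t hs ht hfs hgt hst
    obtain ⟨v, hv, hfv, hgv⟩ := (hS a).exists_update_ne_zero hf hg (hs a) (ht a) hfs hgt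
    refine ih _ _ ((forall_update_iff s fun i y => y ∈ S i).2 ⟨hv, fun i _ => hs i⟩)
      ((forall_update_iff t fun i y => y ∈ S i).2 ⟨hv, fun i _ => ht i⟩) hfv hgv fun i hi => ?_
    by_cases h : i = a
    · subst h; simp
    · simp [h, hst i (by simp [h, hi])]

/-- A function on a basic open subset of a product of irreducible sets which is unchanged by
replacing a single component is constant. -/
lemma eq_of_forall_update_eq [Fintype ι] [DecidableEq ι] (hS : ∀ i, ZariskiIrreducible (S i))
    (hf : f ∈ regularFun ι m ℂ) {β : Type*} (I : (ι → Fin m → ℂ) → β)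
    (hI : ∀ s, (∀ i, s i ∈ S i) → f s ≠ 0 → ∀ i, ∀ v ∈ S i, f (update s i v) ≠ 0 →
      I s = I (update s i v)) {s t : ι → Fin m → ℂ}
    (hs : ∀ i, s i ∈ S i) (ht : ∀ i, t i ∈ S i) (hfs : f s ≠ 0) (hft : f t ≠ 0) : I s = I t := by
  suffices H : ∀ (F : Finset ι) (s t : ι → Fin m → ℂ), (∀ i, s i ∈ S i) → (∀ i, t i ∈ S i) →
      f s ≠ 0 → f t ≠ 0 → (∀ i ∉ F, s i = t i) → I s = I t from
    H Finset.univ s t hs ht hfs hft (by simp)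
  intro F
  induction F using Finset.induction_on with
  | empty =>
    intro s t _ _ _ _ hst
    rw [show s = t from funext fun i => hst i (by simp)]
  | insert a F _ ih =>
    intro s t hs ht hfs hft hst
    obtain ⟨v, hv, hsv, htv⟩ := (hS a).exists_update_ne_zero hf hf (hs a) (ht a) hfs hft
    rw [hI s hs hfs a v hv hsv, hI t ht hft a v hv htv]
    refine ih _ _ ((forall_update_iff s fun i y => y ∈ S i).2 ⟨hv, fun i _ => hs i⟩)
      ((forall_update_iff t fun i y => y ∈ S i).2 ⟨hv, fun i _ => ht i⟩) hsv htv fun i hi => ?_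
    by_cases h : i = a
    · subst h; simp
    · simp [h, hst i (by simp [h, hi])]

end Regular

section RegularFamily

variable {ι : Type*} {m : ℕ} {R : Type*} [CommRing R] [Algebra ℂ R]

/-- A family of subspaces of `R` spanned by polynomial functions of the parameters. -/
def IsRegularFamily (F : (ι → Fin m → ℂ) → Submodule ℂ R) : Prop :=
  ∃ T : Set ((ι → Fin m → ℂ) → R), (∀ b ∈ T, b ∈ regularFun ι m R) ∧
    ∀ x, F x = span ℂ ((fun b => b x) '' T)

lemma isRegularFamily_const (A : Submodule ℂ R) :
    IsRegularFamily fun _ : ι → Fin m → ℂ => A := by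
  refine ⟨(fun a _ => a) '' (A : Set R), ?_, fun x => ?_⟩
  · rintro _ ⟨a, -, rfl⟩
    exact const_mem_regularFun a
  · simp [Set.image_image]

lemma isRegularFamily_span_singleton {b : (ι → Fin m → ℂ) → R} (hb : b ∈ regularFun ι m R) :
    IsRegularFamily fun x => span ℂ {b x} :=
  ⟨{b}, by simpa using hb, fun x => by simp⟩

lemma IsRegularFamily.mul {F G : (ι → Fin m → ℂ) → Submodule ℂ R} (hF : IsRegularFamily F)
    (hG : IsRegularFamily G) : IsRegularFamily fun x => F x * G x := by
  obtain ⟨T, hT, hFT⟩ := hF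
  obtain ⟨U, hU, hGU⟩ := hG
  refine ⟨Set.image2 (· * ·) T U, ?_, fun x => ?_⟩
  · rintro _ ⟨a, ha, b, hb, rfl⟩
    exact mul_mem (hT a ha) (hU b hb)
  · beta_reduce
    rw [hFT, hGU, span_mul_span, ← Set.image2_mul, Set.image2_image_left, Set.image2_image_right,
      Set.image_image2]
    rfl

lemma IsRegularFamily.prod {κ : Type*} (K : Finset κ) {F : κ → (ι → Fin m → ℂ) → Submodule ℂ R}
    (hF : ∀ i, IsRegularFamily (F i)) : IsRegularFamily fun x => ∏ i ∈ K, F i x := by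
  classical
  induction K using Finset.induction_on with
  | empty => simpa using isRegularFamily_const 1
  | insert a K ha ih => simpa only [Finset.prod_insert ha] using (hF a).mul ih

variable {W : Type*} [AddCommGroup W] [Module ℂ W] [FiniteDimensional ℂ W]

lemma le_finrank_span_of_det_ne_zero {n : ℕ} {A : Submodule ℂ W} (l : Fin n → W →ₗ[ℂ] ℂ)
    (v : Fin n → W) (hv : ∀ i, v i ∈ A) (h : (Matrix.of fun i j => l j (v i)).det ≠ 0) :
    n ≤ Module.finrank ℂ A := by
  have hli : LinearIndependent ℂ v :=
    LinearIndependent.of_comp (LinearMap.pi l) (Matrix.linearIndependent_rows_of_det_ne_zero h)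
  have hA : LinearIndependent ℂ fun i => (⟨v i, hv i⟩ : A) :=
    LinearIndependent.of_comp A.subtype hli
  simpa using hA.fintype_card_le_finrank

lemma exists_det_ne_zero_of_le_finrank_span {n : ℕ} {T : Set W}
    (h : n ≤ Module.finrank ℂ (span ℂ T)) :
    ∃ (l : Fin n → W →ₗ[ℂ] ℂ) (v : Fin n → W), (∀ i, v i ∈ T) ∧
      (Matrix.of fun i j => l j (v i)).det ≠ 0 := by
  obtain ⟨v, hvT, -, hv⟩ := exists_fun_fin_finrank_span_eq ℂ T
  have hv' : LinearIndependent ℂ (v ∘ Fin.castLE h) := hv.comp _ (Fin.castLE_injective h)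
  let φ : (Fin n → ℂ) →ₗ[ℂ] W := Fintype.linearCombination ℂ (v ∘ Fin.castLE h)
  obtain ⟨ψ, hψ⟩ := φ.exists_leftInverse_of_injective
    (LinearMap.ker_eq_bot.2 (hv'.fintypeLinearCombination_injective))
  refine ⟨fun j => LinearMap.proj j ∘ₗ ψ, v ∘ Fin.castLE h, fun i => hvT _, ?_⟩
  have : (Matrix.of fun i j => (LinearMap.proj j ∘ₗ ψ) ((v ∘ Fin.castLE h) i)) =
      (1 : Matrix (Fin n) (Fin n) ℂ) := by
    ext i j
    have := congrFun (LinearMap.congr_fun hψ (Pi.single i 1)) j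
    rw [LinearMap.comp_apply, show φ (Pi.single i 1) = (v ∘ Fin.castLE h) i by
      simp [φ, Fintype.linearCombination_apply_single]] at this
    simpa [Matrix.one_apply, Pi.single_apply, eq_comm] using this
  rw [this]
  simp

lemma IsRegularFamily.exists_le_finrank {F : (ι → Fin m → ℂ) → Submodule ℂ R}
    (hF : IsRegularFamily F) (Φ : R →ₗ[ℂ] W) {n : ℕ} {x₀ : ι → Fin m → ℂ}
    (h : n ≤ Module.finrank ℂ ((F x₀).map Φ)) :
    ∃ f ∈ regularFun ι m ℂ, f x₀ ≠ 0 ∧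
      ∀ x, f x ≠ 0 → n ≤ Module.finrank ℂ ((F x).map Φ) := by
  obtain ⟨T, hT, hFT⟩ := hF
  rw [hFT, map_span] at h
  obtain ⟨l, v, hv, hdet⟩ := exists_det_ne_zero_of_le_finrank_span h
  choose c hc hcv using hv
  choose b hb hbc using hc
  refine ⟨fun x => (Matrix.of fun i j => l j (Φ (b i x))).det, ?_, ?_, fun x hx => ?_⟩
  · exact det_mem_regularFun fun i j => linearMap_comp_mem_regularFun (l j ∘ₗ Φ) (hT _ (hb i))
  · simpa [hbc, hcv] using hdet
  · refine le_finrank_span_of_det_ne_zero l (fun i => Φ (b i x)) (fun i => ?_) hx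
    rw [hFT]
    exact mem_map_of_mem (subset_span ⟨b i, hb i, rfl⟩)

end RegularFamily

section GenericFactors

variable {ι : Type*} [Fintype ι] {m : ℕ} {R : Type*} [CommRing R] [Algebra ℂ R]
  {W : Type*} [AddCommGroup W] [Module ℂ W] (Φ : R →ₗ[ℂ] W)
  {S : ι → Set (Fin m → ℂ)} {η : (ι → Fin m → ℂ) → R} {L : Submodule ℂ R}

lemma span_singleton_mul_le_mul {a : R} {U : Submodule ℂ R} (ha : a ∈ U) (A : Submodule ℂ R) :
    span ℂ {a} * A ≤ U * A :=
  mul_le_mul_left ((span_singleton_le_iff_mem _ _).2 ha) A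

/-- If `Φ (η s * A) ⊆ H` for all `s` in a nonempty basic open subset, then the same inclusion
holds for all of `L = span (η s)`. -/
lemma map_mul_le_of_generic (hS : ∀ i, ZariskiIrreducible (S i)) (hη : η ∈ regularFun ι m R)
    (hL : span ℂ (η '' {s | ∀ i, s i ∈ S i}) = L) {A : Submodule ℂ R} {H : Submodule ℂ W}
    {f : (ι → Fin m → ℂ) → ℂ} (hf : f ∈ regularFun ι m ℂ) {s₀ : ι → Fin m → ℂ}
    (hs₀ : ∀ i, s₀ i ∈ S i) (hfs₀ : f s₀ ≠ 0)
    (h : ∀ s, (∀ i, s i ∈ S i) → f s ≠ 0 → (span ℂ {η s} * A).map Φ ≤ H) :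
    (L * A).map Φ ≤ H := by
  rw [map_le_iff_le_comap, ← hL]
  refine mul_le.2 fun l hl a ha => ?_
  induction hl using span_induction with
  | zero => simp
  | add x y _ _ hx hy => rw [add_mul]; exact add_mem hx hy
  | smul c x _ hx => rw [smul_mul_assoc]; exact smul_mem _ c hx
  | mem x hx =>
    obtain ⟨s, hs, rfl⟩ := hx
    by_contra hcon
    obtain ⟨l, hl, hlH⟩ := exists_le_ker_of_notMem (mt mem_comap.2 hcon)
    have hg : (fun s => l (Φ (η s * a))) ∈ regularFun ι m ℂ :=
      linearMap_comp_mem_regularFun (l ∘ₗ Φ) (mul_mem hη (const_mem_regularFun a))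
    obtain ⟨u, hu, hfu, hgu⟩ := exists_forall_mem_and_ne_zero hS hf hg hs₀ hs hfs₀ hl
    exact hgu (hlH (h u hu hfu (mem_map_of_mem (mul_mem_mul (mem_span_singleton_self _) ha))))

variable [FiniteDimensional ℂ W]

lemma exists_le_finrank_map_span_singleton_mul (hS : ∀ i, ZariskiIrreducible (S i))
    (hS₀ : ∃ s : ι → Fin m → ℂ, ∀ i, s i ∈ S i) (hη : η ∈ regularFun ι m R)
    (hL : span ℂ (η '' {s | ∀ i, s i ∈ S i}) = L) {n e : ℕ} {B : Submodule ℂ R} (hne : n ≤ e + 1)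
    (h : n ≤ Module.finrank ℂ ((L ^ (e + 1) * B).map Φ)) :
    ∃ s, (∀ i, s i ∈ S i) ∧ n ≤ Module.finrank ℂ ((span ℂ {η s} * (L ^ e * B)).map Φ) := by
  induction n generalizing e B with
  | zero =>
    obtain ⟨s, hs⟩ := hS₀
    exact ⟨s, hs, Nat.zero_le _⟩
  | succ n ih =>
    by_contra! hlt
    obtain ⟨s₀, hs₀, hns₀⟩ := ih (by omega) (le_of_lt h)
    have hηL {s : ι → Fin m → ℂ} (hs : ∀ i, s i ∈ S i) : η s ∈ L :=
      hL ▸ subset_span ⟨s, hs, rfl⟩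
    obtain ⟨f, hf, hfs₀, hfn⟩ := ((isRegularFamily_span_singleton hη).mul
      (isRegularFamily_const (L ^ e * B))).exists_le_finrank Φ hns₀
    have hconst : ∀ s t : ι → Fin m → ℂ, (∀ i, s i ∈ S i) → (∀ i, t i ∈ S i) → f s ≠ 0 →
        f t ≠ 0 → (span ℂ {η s} * (L ^ e * B)).map Φ = (span ℂ {η t} * (L ^ e * B)).map Φ := by
      intro s t hs ht hfs hft
      rcases n with _ | n
      · rw [finrank_eq_zero.1 (Nat.lt_one_iff.1 (hlt s hs)),
          finrank_eq_zero.1 (Nat.lt_one_iff.1 (hlt t ht))]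
      obtain ⟨e, rfl⟩ : ∃ e', e = e' + 1 := ⟨e - 1, by omega⟩
      have hopen : ∀ s : ι → Fin m → ℂ, (∀ i, s i ∈ S i) → f s ≠ 0 →
          ∃ g ∈ regularFun ι m ℂ, (∃ u, (∀ i, u i ∈ S i) ∧ g u ≠ 0) ∧
            ∀ u, (∀ i, u i ∈ S i) → f u ≠ 0 → g u ≠ 0 →
              (span ℂ {η s} * (L ^ (e + 1) * B)).map Φ =
                (span ℂ {η u} * (L ^ (e + 1) * B)).map Φ := by
        intro s hs hfs
        obtain ⟨u₀, hu₀, hnu₀⟩ := ih (e := e) (B := span ℂ {η s} * B) (by omega) (by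
          rw [mul_left_comm]; exact hfn s hfs)
        obtain ⟨g, hg, hgu₀, hgn⟩ := ((isRegularFamily_span_singleton hη).mul
          (isRegularFamily_const (L ^ e * (span ℂ {η s} * B)))).exists_le_finrank Φ hnu₀
        refine ⟨g, hg, ⟨u₀, hu₀, hgu₀⟩, fun u hu hfu hgu => ?_⟩
        have hle : ∀ v w : ι → Fin m → ℂ, (∀ i, v i ∈ S i) →
            (span ℂ {η v} * (L ^ e * (span ℂ {η w} * B))).map Φ ≤
              (span ℂ {η w} * (L ^ (e + 1) * B)).map Φ := fun v w hv => by
          refine map_mono ((span_singleton_mul_le_mul (hηL hv) _).trans_eq ?_)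
          ring
        have hcomm : span ℂ {η u} * (L ^ e * (span ℂ {η s} * B)) =
            span ℂ {η s} * (L ^ e * (span ℂ {η u} * B)) := by ring
        trans (span ℂ {η u} * (L ^ e * (span ℂ {η s} * B))).map Φ
        · exact (eq_of_le_of_finrank_le (hle u s hu)
            ((Nat.lt_succ_iff.1 (hlt s hs)).trans (hgn u hgu))).symm
        · refine eq_of_le_of_finrank_le ?_ ((Nat.lt_succ_iff.1 (hlt u hu)).trans (hgn u hgu))
          rw [hcomm]
          exact hle s u hs
      obtain ⟨g, hg, ⟨u, hu, hgu⟩, hgs⟩ := hopen s hs hfs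
      obtain ⟨g', hg', ⟨u', hu', hgu'⟩, hgt⟩ := hopen t ht hft
      obtain ⟨x, hx, hgx, hgx'⟩ := exists_forall_mem_and_ne_zero hS hg hg' hu hu' hgu hgu'
      obtain ⟨y, hy, hfy, hggy⟩ := exists_forall_mem_and_ne_zero hS hf (mul_mem hg hg') hs hx hfs
        (mul_ne_zero hgx hgx')
      rw [hgs y hy hfy (left_ne_zero_of_mul hggy), hgt y hy hfy (right_ne_zero_of_mul hggy)]
    have hle := map_mul_le_of_generic Φ hS hη hL (A := L ^ e * B) hf hs₀ hfs₀
      fun s hs hfs => (hconst s s₀ hs hs₀ hfs hfs₀).le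
    rw [← mul_assoc, ← pow_succ'] at hle
    exact (h.trans (finrank_mono hle)).not_gt (hlt s₀ hs₀)

lemma exists_le_finrank_map_mul_span_prod (hS : ∀ i, ZariskiIrreducible (S i))
    (hS₀ : ∃ s : ι → Fin m → ℂ, ∀ i, s i ∈ S i) (hη : η ∈ regularFun ι m R)
    (hL : span ℂ (η '' {s | ∀ i, s i ∈ S i}) = L) {k l : ℕ} {B : Submodule ℂ R}
    (h : k + 1 ≤ Module.finrank ℂ ((L ^ (k + l) * B).map Φ)) :
    ∃ s : Fin l → ι → Fin m → ℂ,
      k + 1 ≤ Module.finrank ℂ ((L ^ k * (span ℂ {∏ j, η (s j)} * B)).map Φ) := by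
  induction l generalizing B with
  | zero => exact ⟨Fin.elim0, by rwa [Fin.prod_univ_zero, ← one_eq_span, one_mul]⟩
  | succ l ih =>
    obtain ⟨s, -, hs⟩ := exists_le_finrank_map_span_singleton_mul Φ hS hS₀ hη hL
      (e := k + l) (by omega) h
    rw [mul_left_comm] at hs
    obtain ⟨t, ht⟩ := ih hs
    refine ⟨Fin.cons s t, ?_⟩
    rw [← mul_assoc (span ℂ _), span_mul_span, Set.singleton_mul_singleton] at ht
    rwa [Fin.prod_univ_succ, mul_comm (η _)]

variable [DecidableEq ι] [Nonempty ι] {p : ℕ} {Y : Set (Fin m → ℂ)}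
  {U : (Fin p → Fin m → ℂ) → Submodule ℂ R}

lemma exists_le_finrank_map_mul_prod (hS : ∀ i, ZariskiIrreducible (S i))
    (hS₀ : ∃ s : ι → Fin m → ℂ, ∀ i, s i ∈ S i) (hη : η ∈ regularFun ι m R)
    (hL : span ℂ (η '' {s | ∀ i, s i ∈ S i}) = L) (hY : ZariskiIrreducible Y)
    (hU : ∀ j, IsRegularFamily fun x : Fin j × Fin p → Fin m → ℂ => ∏ i, U fun c => x (i, c))
    (hηU : ∀ s, (∀ i, s i ∈ S i) → ∀ i, ∀ v ∈ S i,
      ∃ y : Fin p → Fin m → ℂ, (∀ c, y c ∈ Y) ∧ η s ∈ U y ∧ η (update s i v) ∈ U y)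
    {d : ℕ} {B : Submodule ℂ R} (h : d + 1 ≤ Module.finrank ℂ ((L ^ d * B).map Φ))
    {j e : ℕ} (hje : j + e = d) :
    ∃ y : Fin j → Fin p → Fin m → ℂ, (∀ i c, y i c ∈ Y) ∧
      d + 1 ≤ Module.finrank ℂ ((L ^ e * ((∏ i, U (y i)) * B)).map Φ) := by
  induction d generalizing B j e with
  | zero =>
    obtain ⟨rfl, rfl⟩ : j = 0 ∧ e = 0 := by omega
    exact ⟨Fin.elim0, fun i => i.elim0, by rwa [Fin.prod_univ_zero, one_mul]⟩
  | succ d ihd =>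
    induction j generalizing e with
    | zero =>
      obtain rfl : e = d + 1 := by omega
      exact ⟨Fin.elim0, fun i => i.elim0, by rwa [Fin.prod_univ_zero, one_mul]⟩
    | succ j ihj =>
      obtain ⟨y₀, hy₀, hn₀⟩ := ihj (e := e + 1) (by omega)
      obtain ⟨s₀, hs₀, hns₀⟩ := exists_le_finrank_map_span_singleton_mul Φ hS hS₀ hη hL
        (n := d + 1) (e := d) le_rfl (le_of_lt h)
      rw [mul_left_comm] at hns₀
      obtain ⟨y₁, hy₁, hn₁⟩ := ihd hns₀ (j := j) (e := e) (by omega)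
      obtain ⟨f₀, hf₀, hfy₀, hfn₀⟩ := ((isRegularFamily_const (L ^ (e + 1))).mul
        ((hU j).mul (isRegularFamily_const B))).exists_le_finrank Φ
          (x₀ := fun q => y₀ q.1 q.2) hn₀
      obtain ⟨f₁, hf₁, hfy₁, hfn₁⟩ := ((isRegularFamily_const (L ^ e)).mul
        ((hU j).mul (isRegularFamily_const (span ℂ {η s₀} * B)))).exists_le_finrank Φ
          (x₀ := fun q => y₁ q.1 q.2) hn₁
      obtain ⟨x, hx, hx₀, hx₁⟩ := exists_forall_mem_and_ne_zero (S := fun _ => Y) (fun _ => hY)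
        hf₀ hf₁ (fun q => hy₀ q.1 q.2) (fun q => hy₁ q.1 q.2) hfy₀ hfy₁
      set A : Submodule ℂ R := L ^ e * ((∏ i, U fun c => x (i, c)) * B) with hA
      have hLA : d + 1 + 1 ≤ Module.finrank ℂ ((L * A).map Φ) := by
        rw [hA, ← mul_assoc, ← pow_succ']
        exact hfn₀ x hx₀
      have hs₀A : d + 1 ≤ Module.finrank ℂ ((span ℂ {η s₀} * A).map Φ) := by
        have := hfn₁ x hx₁
        rwa [mul_left_comm (∏ i, _), mul_left_comm (L ^ e)] at this
      suffices hex : ∃ y : Fin p → Fin m → ℂ, (∀ c, y c ∈ Y) ∧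
          d + 1 + 1 ≤ Module.finrank ℂ ((U y * A).map Φ) by
        obtain ⟨y, hy, hyA⟩ := hex
        refine ⟨Fin.cons y fun i c => x (i, c), Fin.cases hy fun i c => hx (i, c), ?_⟩
        rw [hA, mul_left_comm, ← mul_assoc (U y)] at hyA
        rwa [Fin.prod_univ_succ]
      by_contra! hlt
      obtain ⟨f, hf, hfs₀, hfn⟩ := ((isRegularFamily_span_singleton hη).mul
        (isRegularFamily_const A)).exists_le_finrank Φ hs₀A
      have hUA : ∀ s y, (∀ c, y c ∈ Y) → f s ≠ 0 → η s ∈ U y →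
          (span ℂ {η s} * A).map Φ = (U y * A).map Φ := fun s y hy hfs hsy =>
        eq_of_le_of_finrank_le (map_mono (span_singleton_mul_le_mul hsy A))
          ((Nat.lt_succ_iff.1 (hlt y hy)).trans (hfn s hfs))
      have hconst := fun s hs hfs => eq_of_forall_update_eq hS hf
        (fun s => (span ℂ {η s} * A).map Φ) (fun s hs hfs i v hv hfv => by
          obtain ⟨y, hy, h1, h2⟩ := hηU s hs i v hv
          exact (hUA s y hy hfs h1).trans (hUA _ y hy hfv h2).symm) (s := s) hs hs₀ hfs hfs₀
      have hle := map_mul_le_of_generic Φ hS hη hL (A := A) hf hs₀ hfs₀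
        fun s hs hfs => (hconst s hs hfs).le
      obtain ⟨y, hy, hsy, -⟩ := hηU s₀ hs₀ (Classical.arbitrary ι) _ (hs₀ _)
      rw [hUA s₀ y hy hfs₀ hsy] at hle
      exact (hLA.trans (finrank_mono hle)).not_gt (hlt y hy)

end GenericFactors

section CrossForm

variable {M p : ℕ}

lemma eval_linFormOf (v x : Fin (M + 1) → ℂ) : eval x (linFormOf M v) = ∑ t, v t * x t := by
  simp [linFormOf]

lemma isHomogeneous_linFormOf (v : Fin (M + 1) → ℂ) : (linFormOf M v).IsHomogeneous 1 :=
  IsHomogeneous.sum _ _ _ fun t _ => isHomogeneous_C_mul_X _ t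

/-- The linear form `x ↦ det (x, w₁, …, w_M)`. -/
noncomputable def crossForm (w : Fin M → Fin (M + 1) → ℂ) : MvPolynomial (Fin (M + 1)) ℂ :=
  linFormOf M fun t => (Matrix.of (Fin.cons (Pi.single t 1) w : Fin (M + 1) → _)).det

lemma eval_crossForm (w : Fin M → Fin (M + 1) → ℂ) (x : Fin (M + 1) → ℂ) :
    eval x (crossForm w) = (Matrix.of (Fin.cons x w : Fin (M + 1) → _)).det := by
  have hminor (y : Fin (M + 1) → ℂ) (j : Fin (M + 1)) :
      (Matrix.of (Fin.cons y w : Fin (M + 1) → _)).submatrix Fin.succ j.succAbove =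
        (Matrix.of w).submatrix id j.succAbove := by
    ext a b
    simp
  rw [crossForm, eval_linFormOf, Matrix.det_succ_row_zero]
  refine Finset.sum_congr rfl fun t _ => ?_
  rw [Matrix.det_succ_row_zero, Finset.sum_eq_single t]
  · simp only [hminor]
    simp
    ring
  · intro j _ hj
    simp [hj]
  · simp

/-- The span of the forms `crossForm w` for the tuples `w` which contain the tuple `y`. -/
noncomputable def crossFormsThrough (y : Fin p → Fin (M + 1) → ℂ) :
    Submodule ℂ (MvPolynomial (Fin (M + 1)) ℂ) :=
  span ℂ {g | ∃ (e : Fin p → Fin M) (z : Fin M → Fin (M + 1) → ℂ), e.Injective ∧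
    g = crossForm (Function.extend e y z)}

lemma crossForm_mem_crossFormsThrough {y : Fin p → Fin (M + 1) → ℂ} {w : Fin M → Fin (M + 1) → ℂ}
    {e : Fin p → Fin M} (he : e.Injective) (h : ∀ c, w (e c) = y c) :
    crossForm w ∈ crossFormsThrough y := by
  refine subset_span ⟨e, w, he, congrArg crossForm (funext fun i => ?_)⟩
  by_cases hi : ∃ c, e c = i
  · obtain ⟨c, rfl⟩ := hi
    rw [he.extend_apply, h]
  · rw [Function.extend_apply' _ _ _ hi]

lemma crossFormsThrough_le (y : Fin p → Fin (M + 1) → ℂ) :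
    crossFormsThrough y ≤ homogeneousSubmodule (Fin (M + 1)) ℂ 1 := by
  refine span_le.2 ?_
  rintro _ ⟨e, z, -, rfl⟩
  exact isHomogeneous_linFormOf _

lemma eval_eq_zero_of_mem_crossFormsThrough {y : Fin p → Fin (M + 1) → ℂ}
    {g : MvPolynomial (Fin (M + 1)) ℂ} (hg : g ∈ crossFormsThrough y) (c : Fin p) :
    eval (y c) g = 0 := by
  induction hg using span_induction with
  | zero => simp
  | add f g _ _ hf hg => simp [hf, hg]
  | smul a f _ hf => simp [hf]
  | mem g hg =>
    obtain ⟨e, z, he, rfl⟩ := hg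
    rw [eval_crossForm]
    refine Matrix.det_zero_of_row_eq (Fin.succ_ne_zero (e c)).symm ?_
    ext t
    simp [he.extend_apply]

lemma linearIndependent_of_crossFormsThrough_ne_bot {y : Fin p → Fin (M + 1) → ℂ}
    (h : crossFormsThrough y ≠ ⊥) : LinearIndependent ℂ y := by
  by_contra hy
  refine h (span_eq_bot.2 ?_)
  rintro _ ⟨e, z, he, rfl⟩
  refine MvPolynomial.funext fun x => ?_
  rw [eval_crossForm, map_zero]
  by_contra hdet
  have hli := (Matrix.linearIndependent_rows_of_det_ne_zero hdet).comp (fun c => (e c).succ)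
    ((Fin.succ_injective M).comp he)
  have hrows : y = (Fin.cons x (Function.extend e y z) : Fin (M + 1) → _) ∘
      fun c => (e c).succ := by
    ext c t
    simp [he.extend_apply]
  refine hy ?_
  rw [hrows]
  exact hli

variable {ι : Type*} {m : ℕ}

lemma linFormOf_mem_regularFun {v : (ι → Fin m → ℂ) → Fin (M + 1) → ℂ}
    (hv : ∀ t, (fun x => v x t) ∈ regularFun ι m ℂ) :
    (fun x => linFormOf M (v x)) ∈ regularFun ι m (MvPolynomial (Fin (M + 1)) ℂ) := by
  have h : (fun x => linFormOf M (v x)) =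
      ∑ t, (fun x => algebraMap ℂ (MvPolynomial (Fin (M + 1)) ℂ) (v x t)) * fun _ => X t := by
    ext1 x
    simp [linFormOf, Finset.sum_apply, algebraMap_eq]
  rw [h]
  exact sum_mem fun t _ => mul_mem (algebraMap_mem_regularFun (hv t)) (const_mem_regularFun _)

lemma crossForm_mem_regularFun {w : (ι → Fin m → ℂ) → Fin M → Fin (M + 1) → ℂ}
    (hw : ∀ i t, (fun x => w x i t) ∈ regularFun ι m ℂ) :
    (fun x => crossForm (w x)) ∈ regularFun ι m (MvPolynomial (Fin (M + 1)) ℂ) := by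
  refine linFormOf_mem_regularFun fun t => det_mem_regularFun fun i j => ?_
  refine Fin.cases ?_ (fun i => ?_) i
  · simpa using const_mem_regularFun _
  · simpa using hw i j

lemma isRegularFamily_crossFormsThrough {y : (ι → Fin m → ℂ) → Fin p → Fin (M + 1) → ℂ}
    (hy : ∀ c t, (fun x => y x c t) ∈ regularFun ι m ℂ) :
    IsRegularFamily fun x => crossFormsThrough (y x) := by
  refine ⟨{b | ∃ (e : Fin p → Fin M) (z : Fin M → Fin (M + 1) → ℂ), e.Injective ∧
    b = fun x => crossForm (Function.extend e (y x) z)}, ?_, fun x => ?_⟩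
  · rintro _ ⟨e, z, he, rfl⟩
    refine crossForm_mem_regularFun fun i t => ?_
    by_cases hi : ∃ c, e c = i
    · obtain ⟨c, rfl⟩ := hi
      simpa only [he.extend_apply] using hy c t
    · simpa only [Function.extend_apply' _ _ _ hi] using const_mem_regularFun (z i t)
  · refine congrArg (span ℂ) (Set.ext fun g => ⟨?_, ?_⟩)
    · rintro ⟨e, z, he, rfl⟩
      exact ⟨_, ⟨e, z, he, rfl⟩, rfl⟩
    · rintro ⟨_, ⟨e, z, he, rfl⟩, rfl⟩
      exact ⟨e, z, he, rfl⟩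

variable {Y : Set (Fin (M + 1) → ℂ)}

/-- The set over which the `i`-th component of an `M`-tuple with its first `p + 1` components
in `Y` varies. -/
def slotSet (p : ℕ) (Y : Set (Fin (M + 1) → ℂ)) (i : ℕ) : Set (Fin (M + 1) → ℂ) :=
  {v | i < p + 1 → v ∈ Y}

lemma ZariskiIrreducible.slotSet (hY : ZariskiIrreducible Y) (i : ℕ) :
    ZariskiIrreducible (slotSet p Y i) := by
  by_cases hi : i < p + 1
  · simpa [_root_.slotSet, hi] using hY
  · simpa [_root_.slotSet, hi] using! zariskiIrreducible_univ (m := M + 1)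

lemma exists_linearIndependent_cons (hspan : Module.finrank ℂ (span ℂ Y) = p + 2)
    {x : Fin (M + 1) → ℂ} (hx : x ≠ 0) {n : ℕ} (hn : n ≤ M) :
    ∃ w : Fin n → Fin (M + 1) → ℂ, (∀ i : Fin n, w i ∈ slotSet p Y i) ∧
      LinearIndependent ℂ (Fin.cons x w : Fin (n + 1) → Fin (M + 1) → ℂ) := by
  induction n with
  | zero =>
    exact ⟨Fin.elim0, fun i => i.elim0, linearIndependent_finCons.2
      ⟨linearIndependent_empty_type, by simpa using hx⟩⟩
  | succ n ih =>
    obtain ⟨w, hw, hli⟩ := ih (by omega)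
    have hfin : Module.finrank ℂ (span ℂ (Set.range (Fin.cons x w : Fin (n + 1) → _))) = n + 1 := by
      simpa using finrank_span_eq_card hli
    obtain ⟨v, hv, hvs⟩ : ∃ v ∈ slotSet p Y n,
        v ∉ span ℂ (Set.range (Fin.cons x w : Fin (n + 1) → _)) := by
      by_contra! hcon
      by_cases hnp : n < p + 1
      · have := finrank_mono (span_le.2 fun v hv => hcon v fun _ => hv)
        omega
      · have htop := eq_top_iff'.2 fun v => hcon v fun h => (hnp h).elim
        rw [htop, finrank_top, Module.finrank_fin_fun] at hfin
        omega
    refine ⟨Fin.snoc w v, Fin.lastCases (by simpa using hv) (by simpa using hw), ?_⟩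
    rw [Fin.cons_snoc_eq_snoc_cons]
    exact linearIndependent_finSnoc.2 ⟨hli, hvs⟩

lemma span_crossForm_eq (hspan : Module.finrank ℂ (span ℂ Y) = p + 2) :
    span ℂ (crossForm '' {w : Fin M → Fin (M + 1) → ℂ | ∀ i : Fin M, w i ∈ slotSet p Y i}) =
      homogeneousSubmodule (Fin (M + 1)) ℂ 1 := by
  refine le_antisymm (span_le.2 ?_) ?_
  · rintro _ ⟨w, -, rfl⟩
    exact isHomogeneous_linFormOf _
  · rw [homogeneousSubmodule_one_eq_span_X, span_le]
    rintro _ ⟨t, rfl⟩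
    by_contra hcon
    obtain ⟨l, hl, hker⟩ := exists_le_ker_of_notMem hcon
    obtain ⟨w, hw, hli⟩ := exists_linearIndependent_cons (p := p) hspan
      (x := fun t => l (X t)) (fun h => hl (congrFun h t)) le_rfl
    have hdet : (Matrix.of (Fin.cons (fun t => l (X t)) w : Fin (M + 1) → _)).det ≠ 0 :=
      ((Matrix.isUnit_iff_isUnit_det _).1 (Matrix.linearIndependent_rows_iff_isUnit.1 hli)).ne_zero
    rw [← eval_crossForm, crossForm, eval_linFormOf] at hdet
    refine hdet ?_
    have := hker (subset_span ⟨w, hw, rfl⟩)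
    simpa [crossForm, linFormOf, ← smul_eq_C_mul] using this

lemma exists_crossForm_mem_crossFormsThrough (hpM : p + 1 ≤ M) (s : Fin M → Fin (M + 1) → ℂ)
    (hs : ∀ i : Fin M, s i ∈ slotSet p Y i) (i : Fin M) (v : Fin (M + 1) → ℂ) :
    ∃ y : Fin p → Fin (M + 1) → ℂ, (∀ c, y c ∈ Y) ∧ crossForm s ∈ crossFormsThrough y ∧
      crossForm (update s i v) ∈ crossFormsThrough y := by
  obtain ⟨e, he, hep, hei⟩ : ∃ e : Fin p → Fin M, e.Injective ∧ (∀ c, (e c : ℕ) < p + 1) ∧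
      ∀ c, e c ≠ i := by
    by_cases hi : (i : ℕ) < p + 1
    · refine ⟨fun c => Fin.castLE hpM (Fin.succAbove ⟨i, hi⟩ c),
        (Fin.castLE_injective hpM).comp Fin.succAbove_right_injective,
        fun c => (Fin.succAbove ⟨i, hi⟩ c).isLt,
        fun c h => Fin.succAbove_ne ⟨i, hi⟩ c (Fin.ext ?_)⟩
      simpa using congrArg Fin.val h
    · exact ⟨fun c => Fin.castLE hpM c.castSucc,
        (Fin.castLE_injective hpM).comp (Fin.castSucc_injective p), fun c => by simp,
        fun c h => hi (by rw [← h]; simp)⟩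
  exact ⟨s ∘ e, fun c => hs (e c) (hep c), crossForm_mem_crossFormsThrough he fun c => rfl,
    crossForm_mem_crossFormsThrough he fun c => update_of_ne (hei c) _ _⟩

end CrossForm


open scoped Pointwise in
lemma prod_mul_span_singleton_le {R : Type*} [CommSemiring R] [Algebra ℂ R] {k : ℕ}
    (U : Fin k → Submodule ℂ R) (a : R) :
    (∏ i, U i) * span ℂ {a} ≤ span ℂ {f | ∃ gs : Fin k → R, (∀ i, gs i ∈ U i) ∧
      f = (∏ i, gs i) * a} := by
  have h : (∏ i, U i) * span ℂ {a} = span ℂ ((∏ i, (U i : Set R)) * {a}) := by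
    rw [← span_mul_span, ← prod_span]
    simp only [span_eq]
  rw [h]
  refine span_mono ?_
  rintro _ ⟨q, hq, _, rfl, rfl⟩
  obtain ⟨gs, hgs, rfl⟩ := (Set.mem_fintype_prod _ _).1 hq
  exact ⟨gs, hgs, rfl⟩

/-- main lemma of [CLR].  `Y ⊆ ℙ^M` is an irreducible closed subvariety
spanning a `ℙ^{p+1}`; it is encoded by its affine cone `Yc ⊆ ℂ^{M+1}` (cut out by
homogeneous polynomials, with prime vanishing ideal, whose linear span has dimension
`p + 2`), points of `Y` being nonzero vectors of `Yc` up to scaling.  Genericity on an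
irreducible parameter variety ("the admissible set contains a nonempty Zariski-open
dense subset") is encoded equivalently as: there is a polynomial `g` in the parameters,
not vanishing identically on the parameter variety, such that every admissible
parameter with `g ≠ 0` is allowed.  Given `0 ≤ r - 1 ≤ k ≤ d` and a linear map
`Ψ : 𝓛_d → ℂ^{k+1}` whose restriction to `𝓛_d(−y₁−⋯−y_{r−1})` is surjective for
general `y₁,…,y_{r−1} ∈ Y`, the restriction of `Ψ` to
`𝓛(−Y₁)⋯𝓛(−Y_k)·h_{k+1}⋯h_d` is surjective for a general choice of `h_{k+1},…,h_d ∈ 𝓛`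
and of subsets `Y₁,…,Y_k ⊂ Y` of cardinality `p` (encoded as tuples of pairwise
non-proportional nonzero vectors of `Yc`) with `y_i ∈ Y_i` (encoded: `y_i` is the
0-th member of `Y_i`) for `i = 1,…,r−1`. -/
theorem stmt_6 (M p d k r : ℕ) (hd : 1 ≤ d) (hrk : r - 1 ≤ k) (hkd : k ≤ d)
    (Yc : Set (Fin (M + 1) → ℂ))
    (hclosed : ∃ T : Set (MvPolynomial (Fin (M + 1)) ℂ),
      (∀ f ∈ T, ∃ j, f.IsHomogeneous j) ∧
      Yc = {x | ∀ f ∈ T, eval x f = 0})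
    (hnontriv : ∃ x ∈ Yc, x ≠ 0)
    (hirr : ∀ f g : MvPolynomial (Fin (M + 1)) ℂ,
      (∀ x ∈ Yc, eval x f * eval x g = 0) →
      (∀ x ∈ Yc, eval x f = 0) ∨ (∀ x ∈ Yc, eval x g = 0))
    (hspan : Module.finrank ℂ ↥(Submodule.span ℂ Yc) = p + 2)
    (Ψ : ↥(homogeneousSubmodule (Fin (M + 1)) ℂ d) →ₗ[ℂ] (Fin (k + 1) → ℂ))
    (hΨ : ∃ g : MvPolynomial (Fin (r - 1) × Fin (M + 1)) ℂ,
      (∃ y : Fin (r - 1) → (Fin (M + 1) → ℂ),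
        (∀ i, y i ∈ Yc ∧ y i ≠ 0) ∧ eval (fun q => y q.1 q.2) g ≠ 0) ∧
      (∀ y : Fin (r - 1) → (Fin (M + 1) → ℂ),
        (∀ i, y i ∈ Yc ∧ y i ≠ 0) → eval (fun q => y q.1 q.2) g ≠ 0 →
        ∀ v : Fin (k + 1) → ℂ,
          ∃ f : ↥(homogeneousSubmodule (Fin (M + 1)) ℂ d),
            (∀ i, eval (y i) (f : MvPolynomial (Fin (M + 1)) ℂ) = 0) ∧ Ψ f = v)) :
    ∃ G : MvPolynomial ((Fin k × Fin p ⊕ Fin (d - k)) × Fin (M + 1)) ℂ,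
      (∃ (Yt : Fin k → Fin p → (Fin (M + 1) → ℂ))
          (h : Fin (d - k) → (Fin (M + 1) → ℂ)),
        (∀ i j, Yt i j ∈ Yc ∧ Yt i j ≠ 0) ∧
        (∀ i, ∀ j j' : Fin p, j ≠ j' → ¬∃ c : ℂ, Yt i j = c • Yt i j') ∧
        eval (fun q => Sum.elim (fun ij : Fin k × Fin p => Yt ij.1 ij.2)
          (fun j : Fin (d - k) => h j) q.1 q.2) G ≠ 0) ∧
      (∀ (Yt : Fin k → Fin p → (Fin (M + 1) → ℂ))
          (h : Fin (d - k) → (Fin (M + 1) → ℂ)),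
        (∀ i j, Yt i j ∈ Yc ∧ Yt i j ≠ 0) →
        (∀ i, ∀ j j' : Fin p, j ≠ j' → ¬∃ c : ℂ, Yt i j = c • Yt i j') →
        eval (fun q => Sum.elim (fun ij : Fin k × Fin p => Yt ij.1 ij.2)
          (fun j : Fin (d - k) => h j) q.1 q.2) G ≠ 0 →
        Submodule.map Ψ (Submodule.span ℂ
          {f : ↥(homogeneousSubmodule (Fin (M + 1)) ℂ d) |
            ∃ gs : Fin k → MvPolynomial (Fin (M + 1)) ℂ,
              (∀ i, gs i ∈ homogeneousSubmodule (Fin (M + 1)) ℂ 1 ∧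
                ∀ j, eval (Yt i j) (gs i) = 0) ∧
              (f : MvPolynomial (Fin (M + 1)) ℂ) =
                (∏ i, gs i) * ∏ j, linFormOf M (h j)}) = ⊤) := by
  have hspan' : Module.finrank ℂ (span ℂ Yc) = p + 2 := hspan
  have hpM : p + 1 ≤ M := by
    have := finrank_le (span ℂ Yc)
    rw [hspan', Module.finrank_fin_fun] at this
    omega
  have : Nonempty (Fin M) := ⟨⟨0, by omega⟩⟩
  have hS₀ : ∃ s : Fin M → Fin (M + 1) → ℂ, ∀ i : Fin M, s i ∈ slotSet p Yc i := by
    obtain ⟨x, -, hx⟩ := hnontriv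
    obtain ⟨w, hw, -⟩ := exists_linearIndependent_cons hspan' hx le_rfl
    exact ⟨w, hw⟩
  have hη : crossForm ∈ regularFun (Fin M) (M + 1) (MvPolynomial (Fin (M + 1)) ℂ) :=
    crossForm_mem_regularFun (w := id) fun i t => coord_mem_regularFun (R := ℂ) i t
  have hS (i : Fin M) : ZariskiIrreducible (slotSet p Yc i) :=
    ZariskiIrreducible.slotSet hirr i
  obtain ⟨Φ, hΦ⟩ := Ψ.exists_extend
  have hΦΨ (f : homogeneousSubmodule (Fin (M + 1)) ℂ d) : Φ f = Ψ f :=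
    LinearMap.congr_fun hΦ f
  have htop : (homogeneousSubmodule (Fin (M + 1)) ℂ 1 ^ (k + (d - k)) * 1).map Φ = ⊤ := by
    rw [mul_one, homogeneousSubmodule_one_pow, Nat.add_sub_cancel' hkd]
    obtain ⟨g, ⟨y, hy, hgy⟩, hg⟩ := hΨ
    refine eq_top_iff'.2 fun v => ?_
    obtain ⟨f, -, rfl⟩ := hg y hy hgy v
    exact ⟨f, f.2, hΦΨ f⟩
  obtain ⟨s, hs⟩ := exists_le_finrank_map_mul_span_prod Φ hS hS₀ hη (span_crossForm_eq hspan')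
    (k := k) (l := d - k) (B := 1) (by rw [htop, finrank_top, Module.finrank_fin_fun])
  obtain ⟨y, hyY, hy⟩ := exists_le_finrank_map_mul_prod Φ hS hS₀ hη (span_crossForm_eq hspan') hirr
    (fun j => IsRegularFamily.prod _ fun i => isRegularFamily_crossFormsThrough
      fun c t => coord_mem_regularFun (R := ℂ) (i, c) t)
    (fun s hs i v _ => exists_crossForm_mem_crossFormsThrough hpM s hs i v) hs
    (j := k) (e := 0) (add_zero k)
  rw [pow_zero, one_mul, mul_one] at hy
  let F (x : Fin k × Fin p ⊕ Fin (d - k) → Fin (M + 1) → ℂ) :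
      Submodule ℂ (MvPolynomial (Fin (M + 1)) ℂ) :=
    (∏ i, crossFormsThrough fun c => x (.inl (i, c))) *
      span ℂ {∏ j, linFormOf M (x (.inr j))}
  have hF : IsRegularFamily F := by
    have hprod : IsRegularFamily fun x : Fin k × Fin p ⊕ Fin (d - k) → Fin (M + 1) → ℂ =>
        ∏ j, span ℂ {linFormOf M (x (.inr j))} :=
      IsRegularFamily.prod _ fun j => isRegularFamily_span_singleton
        (linFormOf_mem_regularFun fun t => coord_mem_regularFun (R := ℂ) (Sum.inr j) t)
    simp only [prod_span_singleton] at hprod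
    exact (IsRegularFamily.prod _ fun i => isRegularFamily_crossFormsThrough
      fun c t => coord_mem_regularFun (R := ℂ) _ t).mul hprod
  let h₀ (j : Fin (d - k)) : Fin (M + 1) → ℂ := fun t =>
    (Matrix.of (Fin.cons (Pi.single t 1) (s j) : Fin (M + 1) → _)).det
  obtain ⟨f, hf, hf₀, hfF⟩ := hF.exists_le_finrank Φ
    (x₀ := Sum.elim (fun ij : Fin k × Fin p => y ij.1 ij.2) h₀) hy
  obtain ⟨G, hG⟩ := exists_eval_eq_of_mem_regularFun hf
  have hli (i : Fin k) : LinearIndependent ℂ (y i) := by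
    refine linearIndependent_of_crossFormsThrough_ne_bot fun hbot => ?_
    rw [Finset.prod_eq_zero (Finset.mem_univ i) (hbot.trans zero_eq_bot.symm), zero_mul,
      zero_eq_bot, Submodule.map_bot, finrank_bot] at hy
    omega
  refine ⟨G, ⟨y, h₀, fun i c => ⟨hyY i c, (hli i).ne_zero c⟩, ?_, ?_⟩, ?_⟩
  · rintro i c c' hcc ⟨a, ha⟩
    exact linearIndependent_iff_notMem_span.1 (hli i) c
      (ha ▸ smul_mem _ a (subset_span ⟨c', by simp [hcc.symm], rfl⟩))
  · exact fun h => hf₀ ((hG _).trans h)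
  · intro Yt h _ _ hGne
    have hrank := hfF (Sum.elim (fun ij : Fin k × Fin p => Yt ij.1 ij.2) h)
      fun h0 => hGne ((hG _).symm.trans h0)
    have hFtop : (F (Sum.elim (fun ij : Fin k × Fin p => Yt ij.1 ij.2) h)).map Φ = ⊤ :=
      eq_top_of_finrank_eq (le_antisymm (finrank_le _) (by simpa using hrank))
    rw [eq_top_iff, ← hFtop, map_le_iff_le_comap]
    refine (prod_mul_span_singleton_le _ _).trans (span_le.2 ?_)
    rintro _ ⟨gs, hgs, rfl⟩
    simp only [Sum.elim_inl, Sum.elim_inr] at hgs ⊢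
    have hhom : ((∏ i, gs i) * ∏ j, linFormOf M (h j)).IsHomogeneous d := by
      have h1 := IsHomogeneous.prod Finset.univ gs (fun _ => 1)
        fun i _ => crossFormsThrough_le _ (hgs i)
      have h2 := IsHomogeneous.prod Finset.univ (fun j => linFormOf M (h j)) (fun _ => 1)
        fun j _ => isHomogeneous_linFormOf (h j)
      simpa [Nat.add_sub_cancel' hkd] using h1.mul h2
    refine ⟨⟨_, hhom⟩, subset_span ⟨gs, fun i => ⟨crossFormsThrough_le _ (hgs i),
      eval_eq_zero_of_mem_crossFormsThrough (hgs i)⟩, rfl⟩, (hΦΨ _).symm⟩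
end

section
/- Let d ≥ 6 be an integer. There exists a nonzero polynomial function P on the ℂ-vector space 𝓛_d of homogeneous degree-d polynomials in x₀,…,x₄ such that for every F ∈ 𝓛_d with P(F) ≠ 0, the hypersurface V₊(F) ⊂ ℙ⁴_ℂ contains no line: there is no 2-dimensional linear subspace W ⊂ ℂ⁵ such that F vanishes identically on W. -/
open MvPolynomial

/-- Evaluation of a polynomial function on the space `𝓛_d` of degree-`d` forms in
`x₀, …, x₄`: a polynomial `P` in the monomial coefficients, evaluated at the
coefficients of `F`. -/
noncomputable def coeffPolyEval (d : ℕ) (P : MvPolynomial (Fin 5 →₀ ℕ) ℂ)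
    (F : ↥(homogeneousSubmodule (Fin 5) ℂ d)) : ℂ :=
  MvPolynomial.eval (fun s => MvPolynomial.coeff s (F : MvPolynomial (Fin 5) ℂ)) P

/-- Fewer variables than polynomials force a nontrivial polynomial relation, which then holds on
all values of the corresponding polynomial map. -/
theorem MvPolynomial.exists_relation_of_card_lt {K ι τ : Type} [Field K] [Fintype ι] [Fintype τ]
    (h : Fintype.card τ < Fintype.card ι) (g : ι → MvPolynomial τ K) :
    ∃ Q : MvPolynomial ι K, Q ≠ 0 ∧ ∀ v : τ → K, eval (fun s => eval v (g s)) Q = 0 := by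
  have hg : ¬ AlgebraicIndependent K g := fun hg => by
    have := hg.cardinalMk_le_trdeg
    rw [MvPolynomial.trdeg_of_isDomain, Cardinal.lift_id] at this
    simp only [Cardinal.mk_fintype, Nat.cast_le] at this
    omega
  rw [algebraicIndependent_iff] at hg
  push Not at hg
  obtain ⟨Q, hQ, hQ0⟩ := hg
  refine ⟨Q, hQ0, fun v => ?_⟩
  have h1 := congrArg (eval v) hQ
  rw [map_zero, ← coe_aeval_eq_eval, RingHom.coe_coe, ← AlgHom.comp_apply, comp_aeval] at h1
  exact h1

/-- The coordinate change adding `a l * x i + b l * x j` to each `x l` with `l ≠ i, j`. -/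
noncomputable def lineShear {σ R : Type*} [DecidableEq σ] [CommRing R] (i j : σ) (a b : σ → R)
    (l : σ) : MvPolynomial σ R :=
  if l = i ∨ l = j then X l else X l + C (a l) * X i + C (b l) * X j

section lineShear

variable {σ R : Type*} [DecidableEq σ] [CommRing R] (i j : σ) (a b : σ → R)

theorem map_lineShear {S : Type*} [CommRing S] (f : R →+* S) (l : σ) :
    map f (lineShear i j a b l) = lineShear i j (fun k => f (a k)) (fun k => f (b k)) l := by
  unfold lineShear
  split_ifs <;> simp

theorem isHomogeneous_lineShear (l : σ) : (lineShear i j a b l).IsHomogeneous 1 := by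
  unfold lineShear
  split_ifs
  · exact isHomogeneous_X R l
  · exact ((isHomogeneous_X R l).add (isHomogeneous_C_mul_X _ _)).add (isHomogeneous_C_mul_X _ _)

theorem aeval_neg_lineShear_aeval_lineShear (F : MvPolynomial σ R) :
    aeval (lineShear i j (-a) (-b)) (aeval (lineShear i j a b) F) = F := by
  rw [← AlgHom.comp_apply, comp_aeval]
  conv_rhs => rw [← aeval_X_left_apply F]
  congr 2
  funext l
  by_cases h : l = i ∨ l = j
  · simp [lineShear, h]
  · simp [lineShear, h]
    ring

end lineShear

/-- A polynomial vanishing at all points supported on `s` has no monomials supported on `s`. -/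
theorem MvPolynomial.coeff_eq_zero_of_eval_eq_zero {σ K : Type*} [DecidableEq σ] [Field K]
    [Infinite K] (s : Finset σ) (G : MvPolynomial σ K)
    (hG : ∀ x : σ → K, (∀ l ∉ s, x l = 0) → eval x G = 0)
    (m : σ →₀ ℕ) (hm : m.support ⊆ s) : coeff m G = 0 := by
  have key : ∀ G : MvPolynomial σ K,
      coeff m (aeval (fun l => if l ∈ s then (X l : MvPolynomial σ K) else 0) G) = coeff m G := by
    intro G
    induction G using MvPolynomial.induction_on' with
    | add p q hp hq => rw [map_add, coeff_add, coeff_add, hp, hq]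
    | monomial u c =>
      by_cases hu : u.support ⊆ s
      · rw [aeval_monomial, monomial_eq]
        congr 2
        refine Finsupp.prod_congr fun l hl => ?_
        rw [if_pos (hu hl)]
      · obtain ⟨l, hl, hls⟩ := Finset.not_subset.mp hu
        have hne : u ≠ m := by rintro rfl; exact hu hm
        rw [aeval_monomial, coeff_monomial, if_neg hne, Finsupp.prod,
          Finset.prod_eq_zero hl, mul_zero, coeff_zero]
        rw [if_neg hls, zero_pow (Finsupp.mem_support_iff.mp hl)]
  rw [← key G]
  suffices h : aeval (fun l => if l ∈ s then (X l : MvPolynomial σ K) else 0) G = 0 by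
    rw [h, coeff_zero]
  refine MvPolynomial.funext fun x => ?_
  rw [map_zero, ← hG (fun l => if l ∈ s then x l else 0) fun l hl => if_neg hl,
    ← coe_aeval_eq_eval, RingHom.coe_coe, ← AlgHom.comp_apply, comp_aeval, ← coe_aeval_eq_eval,
    RingHom.coe_coe]
  congr 2
  funext l
  split_ifs <;> simp

/-- A plane in `K ^ n` is a graph over some pair of coordinates. -/
theorem Submodule.exists_pair_of_finrank_eq_two {σ K : Type*} [Field K]
    (W : Submodule K (σ → K)) (hW : Module.finrank K W = 2) :
    ∃ i j : σ, i ≠ j ∧ ∃ a ∈ W, ∃ b ∈ W, a i = 1 ∧ a j = 0 ∧ b i = 0 ∧ b j = 1 := by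
  have : Module.Finite K W := Module.finite_of_finrank_pos (by omega)
  let B := Module.finBasisOfFinrankEq K W hW
  set u : σ → K := ((B 0 : W) : σ → K)
  set v : σ → K := ((B 1 : W) : σ → K)
  have hind : ∀ s t : K, s • u + t • v = 0 → s = 0 ∧ t = 0 := by
    intro s t hst
    have h := Fintype.linearIndependent_iff.mp B.linearIndependent ![s, t]
      (Subtype.ext (by simpa [Fin.sum_univ_two] using hst))
    exact ⟨by simpa using h 0, by simpa using h 1⟩
  obtain ⟨i, hi⟩ : ∃ i, u i ≠ 0 := by
    by_contra! h
    exact one_ne_zero (hind 1 0 (by funext l; simp [h l])).1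
  obtain ⟨j, hj⟩ : ∃ j, u i * v j - v i * u j ≠ 0 := by
    by_contra! h
    exact hi (hind (-v i) (u i) (by funext l; simp; linear_combination h l)).2
  have huW : u ∈ W := (B 0).2
  have hvW : v ∈ W := (B 1).2
  refine ⟨i, j, ?_, (u i * v j - v i * u j)⁻¹ • (v j • u - u j • v),
    W.smul_mem _ (W.sub_mem (W.smul_mem _ huW) (W.smul_mem _ hvW)),
    (u i * v j - v i * u j)⁻¹ • (u i • v - v i • u),
    W.smul_mem _ (W.sub_mem (W.smul_mem _ hvW) (W.smul_mem _ huW)), ?_, ?_, ?_, ?_⟩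
  · rintro rfl
    exact hj (by ring)
  · simp only [Pi.smul_apply, Pi.sub_apply, smul_eq_mul]
    rw [← inv_mul_cancel₀ hj]; ring
  · simp only [Pi.smul_apply, Pi.sub_apply, smul_eq_mul]; ring
  · simp only [Pi.smul_apply, Pi.sub_apply, smul_eq_mul]; ring
  · simp only [Pi.smul_apply, Pi.sub_apply, smul_eq_mul]
    exact inv_mul_cancel₀ hj

/-- The exponents of the degree-`d` monomials in five variables. -/
def monomialExponents (d : ℕ) : Finset (Fin 5 →₀ ℕ) := Finset.univ.finsuppAntidiag d

theorem mem_monomialExponents {d : ℕ} {m : Fin 5 →₀ ℕ} :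
    m ∈ monomialExponents d ↔ m.degree = d := by
  simp [monomialExponents, Finsupp.degree_eq_sum]

theorem card_filter_support_subset_pair {d : ℕ} {i j : Fin 5} (hij : i ≠ j) :
    d + 1 ≤ ((monomialExponents d).filter (fun m => m.support ⊆ {i, j})).card := by
  rw [← Finset.card_range (d + 1)]
  refine Finset.card_le_card_of_injOn
    (fun k => Finsupp.single i k + Finsupp.single j (d - k)) (fun k hk => ?_) ?_
  · have hk : k ≤ d := by simpa [Nat.lt_succ_iff] using hk
    simp only [Finset.coe_filter, Set.mem_ofPred_eq, mem_monomialExponents, map_add,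
      Finsupp.degree_single]
    refine ⟨by omega, Finsupp.support_add.trans (Finset.union_subset ?_ ?_)⟩
    · exact Finsupp.support_single_subset.trans (by simp)
    · exact Finsupp.support_single_subset.trans (by simp)
  · intro k _ k' _ h
    simpa [hij] using DFunLike.congr_fun h i

/-- The forms vanishing on some plane that is a graph over the coordinates `i, j` satisfy a
nontrivial polynomial relation in their coefficients. -/
theorem exists_relation_of_vanishing_on_chart {d : ℕ} (hd : 6 ≤ d) {i j : Fin 5} (hij : i ≠ j) :
    ∃ Q : MvPolynomial (monomialExponents d) ℂ, Q ≠ 0 ∧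
      ∀ F : MvPolynomial (Fin 5) ℂ, F.IsHomogeneous d → ∀ a b : Fin 5 → ℂ,
        a i = 1 → a j = 0 → b i = 0 → b j = 1 → (∀ p q : ℂ, eval (p • a + q • b) F = 0) →
        eval (fun s => coeff s.1 F) Q = 0 := by
  let N := (monomialExponents d).filter (fun m => ¬ m.support ⊆ {i, j})
  let τ := ({l : Fin 5 // ¬ (l = i ∨ l = j)} × Bool) ⊕ N
  let param (e : Bool) (l : Fin 5) : MvPolynomial τ ℂ :=
    if h : l = i ∨ l = j then 0 else X (Sum.inl (⟨l, h⟩, e))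
  let generic : MvPolynomial (Fin 5) (MvPolynomial τ ℂ) :=
    ∑ s : N, C (X (Sum.inr s)) * s.1.prod fun l k => lineShear i j (param false) (param true) l ^ k
  have hcard : Fintype.card τ < Fintype.card (monomialExponents d) := by
    have h1 := card_filter_support_subset_pair (d := d) hij
    have h2 := Finset.card_filter_add_card_filter_not (s := monomialExponents d)
      (fun m => m.support ⊆ {i, j})
    have h3 : Fintype.card {l : Fin 5 // ¬ (l = i ∨ l = j)} = 3 := by
      clear h1 h2
      revert i j
      decide
    simp only [τ, Fintype.card_sum, Fintype.card_prod, h3, Fintype.card_bool, Fintype.card_coe, N]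
    omega
  obtain ⟨Q, hQ0, hQ⟩ := exists_relation_of_card_lt hcard (fun s => coeff s.1 generic)
  refine ⟨Q, hQ0, fun F hF a b hai haj hbi hbj hab => ?_⟩
  set G := aeval (lineShear i j a b) F with hGdef
  have hG : G.IsHomogeneous d := by
    rw [← one_mul d]
    exact hF.aeval _ (isHomogeneous_lineShear i j a b)
  have hG0 : ∀ m : Fin 5 →₀ ℕ, m.support ⊆ {i, j} → coeff m G = 0 := by
    refine coeff_eq_zero_of_eval_eq_zero _ G fun x hx => ?_
    rw [← hab (x i) (x j), hGdef, ← coe_aeval_eq_eval, RingHom.coe_coe, ← AlgHom.comp_apply,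
      comp_aeval, ← coe_aeval_eq_eval, RingHom.coe_coe]
    congr 2
    funext l
    rcases eq_or_ne l i with rfl | hli
    · simp [lineShear, hai, hbi]
    rcases eq_or_ne l j with rfl | hlj
    · simp [lineShear, haj, hbj]
    simp [lineShear, hli, hlj, hx l (by simp [hli, hlj])]
    ring
  let v : τ → ℂ := Sum.elim (fun p => if p.2 then - b p.1.1 else - a p.1.1) (fun s => coeff s.1 G)
  have hmap : map (eval v) generic = F := by
    have hshear : ∀ l, map (eval v) (lineShear i j (param false) (param true) l) =
        lineShear i j (-a) (-b) l := by
      intro l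
      rw [map_lineShear]
      unfold lineShear
      split_ifs with h
      · rfl
      · simp [param, h, v]
    have hsum : G = ∑ s : N, monomial s.1 (coeff s.1 G) := by
      rw [Finset.sum_coe_sort N (fun s => monomial s (coeff s G))]
      conv_lhs => rw [G.as_sum]
      refine Finset.sum_subset (fun m hm => ?_) (fun m _ hm => by simp [notMem_support_iff.mp hm])
      have hm' := mem_support_iff.mp hm
      refine Finset.mem_filter.mpr ⟨mem_monomialExponents.mpr ?_, fun h => hm' (hG0 m h)⟩
      by_contra hne
      exact hm' (hG.coeff_eq_zero hne)
    calc map (eval v) generic = aeval (lineShear i j (-a) (-b)) G := by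
          rw [hsum]
          simp [generic, bind₁_monomial, Finsupp.prod, hshear, v]
      _ = F := aeval_neg_lineShear_aeval_lineShear i j a b F
  have := hQ v
  simpa only [← coeff_map, hmap] using this

/-- for `d ≥ 6` there is a nonzero polynomial function `P` on `𝓛_d` such
that whenever `P(F) ≠ 0`, the hypersurface `V₊(F) ⊂ ℙ⁴` contains no line: there is no
2-dimensional linear subspace `W ⊂ ℂ⁵` on which `F` vanishes identically. -/
theorem stmt_8 (d : ℕ) (hd : 6 ≤ d) :
    ∃ P : MvPolynomial (Fin 5 →₀ ℕ) ℂ,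
      (∃ F : ↥(homogeneousSubmodule (Fin 5) ℂ d), coeffPolyEval d P F ≠ 0) ∧
      ∀ F : ↥(homogeneousSubmodule (Fin 5) ℂ d), coeffPolyEval d P F ≠ 0 →
        ¬ ∃ W : Submodule ℂ (Fin 5 → ℂ), Module.finrank ℂ W = 2 ∧
            ∀ w ∈ W, eval w (F : MvPolynomial (Fin 5) ℂ) = 0 := by
  choose Q hQ0 hQ using fun p : {p : Fin 5 × Fin 5 // p.1 ≠ p.2} =>
    exists_relation_of_vanishing_on_chart hd p.2
  have heval : ∀ F : ↥(homogeneousSubmodule (Fin 5) ℂ d),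
      coeffPolyEval d (rename Subtype.val (∏ p, Q p)) F =
        eval (fun s : monomialExponents d => coeff s.1 F.1) (∏ p, Q p) := fun F => by
    rw [coeffPolyEval, eval_rename]
    rfl
  refine ⟨rename Subtype.val (∏ p, Q p), ?_, fun F hF => ?_⟩
  · have hprod : ∏ p, Q p ≠ 0 := Finset.prod_ne_zero_iff.mpr fun p _ => hQ0 p
    obtain ⟨x, hx⟩ : ∃ x, eval x (∏ p, Q p) ≠ 0 := by
      by_contra! h
      exact hprod (MvPolynomial.funext fun x => by rw [h x, map_zero])
    have hF : (∑ s : monomialExponents d, monomial s.1 (x s)) ∈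
        homogeneousSubmodule (Fin 5) ℂ d :=
      Submodule.sum_mem _ fun s _ => isHomogeneous_monomial _ (mem_monomialExponents.mp s.2)
    refine ⟨⟨_, hF⟩, ?_⟩
    rw [heval]
    convert hx using 3
    funext s
    simp [coeff_sum, coeff_monomial]
  · rintro ⟨W, hW, hWF⟩
    obtain ⟨i, j, hij, a, ha, b, hb, hai, haj, hbi, hbj⟩ := W.exists_pair_of_finrank_eq_two hW
    refine hF ?_
    rw [heval, map_prod]
    exact Finset.prod_eq_zero (Finset.mem_univ ⟨(i, j), hij⟩)
      (hQ ⟨(i, j), hij⟩ F.1 F.2 a b hai haj hbi hbj fun p q =>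
        hWF _ (W.add_mem (W.smul_mem p ha) (W.smul_mem q hb)))
end
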